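/- Let d = 3 and assume b is twice continuously differentiable on the open set Σ_{2,χ}. Let η ∈ S_{e_3} and σ ∈ Σ2 be such that η, σ, ν are linearly independent. If g : ℝ³ → ℂ is a continuous solution of the homogeneous system and Db(σ)(ν × σ) ≠ 0, then g(η − σ) = 0. -/

import Mathlib

open Set MeasureTheory
open scoped RealInnerProductSpace

noncomputable section

abbrev Euc (d : ℕ) := EuclideanSpace ℝ (Fin d)

/-- Reflection across the hyperplane `ν^⊥` (Householder transform). -/
def Hr {d : ℕ} (ν x : Euc d) : Euc d := x - (2 * ⟪x, ν⟫) • ν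

/-- Open hemisphere of radius `k0` in direction `v`. -/
def Shemi {d : ℕ} (k0 : ℝ) (v : Euc d) : Set (Euc d) := {x | ‖x‖ = k0 ∧ 0 < ⟪x, v⟫}

def Sig1 {d : ℕ} (k0 : ℝ) (ν ω : Euc d) : Set (Euc d) :=
  {σ | σ ∈ Shemi k0 ω ∧ Hr ν σ ∉ Shemi k0 ω}

def Sig2 {d : ℕ} (k0 : ℝ) (ν ω : Euc d) : Set (Euc d) :=
  {σ | σ ∈ Shemi k0 ω ∧ Hr ν σ ∈ Shemi k0 ω}

def Y1set {d : ℕ} (k0 : ℝ) (ν ω e : Euc d) : Set (Euc d) :=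
  {y | ∃ η ∈ Shemi k0 e, ∃ σ ∈ Sig1 k0 ν ω, y = η - σ}

def Y2set {d : ℕ} (k0 : ℝ) (ν ω e : Euc d) : Set (Euc d) :=
  {y | ∃ η ∈ Shemi k0 e, ∃ σ ∈ Sig2 k0 ν ω, y = η - σ}

def Sig2chi {d : ℕ} (k0 χ : ℝ) (ν ω : Euc d) : Set (Euc d) :=
  {x | ∃ σ ∈ Sig2 k0 ν ω, ∃ t ∈ Set.Ioo (1 - χ) (1 + χ), x = t • σ}

/-- The hypotheses on the coefficient function `b`. -/
def BHyp {d : ℕ} (k0 χ : ℝ) (ν ω : Euc d) (b : Euc d → ℂ) : Prop :=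
  (∀ x ∈ Sig2chi k0 χ ν ω, b x ≠ 0) ∧
  ∀ σ ∈ Sig2 k0 ν ω, ∀ t ∈ Set.Ioo (1 - χ) (1 + χ), b (t • σ) = b σ

/-- `g` solves the homogeneous system. -/
def SolvesHom {d : ℕ} (k0 : ℝ) (ν ω e : Euc d) (b g : Euc d → ℂ) : Prop :=
  ∀ η ∈ Shemi k0 e,
    (∀ σ ∈ Sig1 k0 ν ω, g (η - σ) = 0) ∧
    ∀ σ ∈ Sig2 k0 ν ω, b σ * g (η - σ) + g (η - Hr ν σ) = 0

/-- The coupling set `F_y`. -/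
def Fcoup {d : ℕ} (k0 : ℝ) (ν ω e : Euc d) (y : Euc d) : Set (Euc d) :=
  {z | ∃ η ∈ Shemi k0 e, ∃ σ ∈ Sig2 k0 ν ω, y = η - σ ∧ z = η - Hr ν σ}

/-- The set `C_{y,λ}`. -/
def Cset {d : ℕ} (k0 : ℝ) (ν ω e : Euc d) (y : Euc d) (lam : ℝ) : Set (Euc d) :=
  {σ | σ ∈ Sig2 k0 ν ω ∧ σ + y ∈ Shemi k0 e ∧ ⟪σ, ν⟫ = lam}

/-- The `d`-th standard basis vector. -/
def eLast (d : ℕ) (hd : 0 < d) : Euc d :=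
  EuclideanSpace.single ⟨d - 1, Nat.sub_lt hd one_pos⟩ 1

def e2 : Euc 2 := EuclideanSpace.single 1 1
def e3 : Euc 3 := EuclideanSpace.single 2 1

/-- Degenerate points. -/
def degS {d : ℕ} (k0 : ℝ) (ν ω e : Euc d) : Set (Euc d) :=
  {y | ∃ η ∈ Shemi k0 e, ∃ σ ∈ Sig2 k0 ν ω, (⟪η, ν⟫ = 0 ∨ ⟪σ, ν⟫ = 0) ∧ y = η - σ}

/-- Non-degenerate points `Y2'`. -/
def Y2nd {d : ℕ} (k0 : ℝ) (ν ω e : Euc d) : Set (Euc d) :=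
  (Y2set k0 ν ω e ∩ {x | ‖x‖ < 2 * k0}) \
    (degS k0 ν ω e ∪ {x | ⟪x, ν⟫ = 0} ∪ {x | ∃ t : ℝ, x = t • ν})

/-- The set `Ỹ`. -/
def Ytil {d : ℕ} (k0 : ℝ) (ν ω e : Euc d) : Set (Euc d) :=
  {y | ∃ η ∈ Shemi k0 e, -η ∈ Sig1 k0 ν ω ∧
    ∃ σ ∈ Sig2 k0 ν ω, σ ∈ Shemi k0 (-e) ∧ Hr ν σ ∉ Shemi k0 (-e) ∧ y = η - Hr ν σ}

/-- Cross product on `Euc 3`. -/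
def cross3 (a b : Euc 3) : Euc 3 :=
  (EuclideanSpace.equiv (Fin 3) ℝ).symm
    ![a 1 * b 2 - a 2 * b 1, a 2 * b 0 - a 0 * b 2, a 0 * b 1 - a 1 * b 0]

end

open Filter Topology

/-- The mixed derivative of the relation `b (S s t) b (S s₀ t₀) = b (S s t₀) b (S s₀ t)`. -/
lemma mixed_deriv_of_multiplicative {E : Type*} [NormedAddCommGroup E] [NormedSpace ℝ E]
    {b : E → ℂ} {σ : E} (hb : ContDiffAt ℝ 2 b σ) {S : ℝ → ℝ → E} {S1 : ℝ → E} {S2 S12 : E}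
    {s0 t0 : ℝ} (h0 : S s0 t0 = σ)
    (h1 : ∀ᶠ t in 𝓝 t0, HasDerivAt (fun s => S s t) (S1 t) s0)
    (h2 : HasDerivAt (S s0) S2 t0) (h12 : HasDerivAt S1 S12 t0)
    (hF : ∀ᶠ t in 𝓝 t0, ∀ᶠ s in 𝓝 s0, b (S s t) * b σ = b (S s t0) * b (S s0 t)) :
    (fderiv ℝ (fderiv ℝ b) σ S2 (S1 t0) + fderiv ℝ b σ S12) * b σ
      = fderiv ℝ b σ (S1 t0) * fderiv ℝ b σ S2 := by
  have hbd : DifferentiableAt ℝ b σ := hb.differentiableAt (by norm_num)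
  have hnear : ∀ᶠ x in 𝓝 σ, DifferentiableAt ℝ b x :=
    (hb.eventually (by simp)).mono fun x hx => hx.differentiableAt (by norm_num)
  have hS : Tendsto (S s0) (𝓝 t0) (𝓝 σ) := by
    have := h2.continuousAt.tendsto
    rwa [h0] at this
  have hfd : DifferentiableAt ℝ (fderiv ℝ b) σ :=
    (hb.fderiv_right (m := 1) (by norm_num)).differentiableAt (by norm_num)
  have hE : (fun t => fderiv ℝ b (S s0 t) (S1 t) * b σ)
      =ᶠ[𝓝 t0] fun t => fderiv ℝ b σ (S1 t0) * b (S s0 t) := by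
    filter_upwards [hS.eventually hnear, h1, hF] with t ht h1t hFt
    have hl : HasDerivAt (fun s => b (S s t) * b σ)
        (fderiv ℝ b (S s0 t) (S1 t) * b σ) s0 :=
      (ht.hasFDerivAt.comp_hasDerivAt s0 h1t).mul_const _
    have hbσ : HasFDerivAt b (fderiv ℝ b σ) (S s0 t0) := by
      rw [h0]; exact hbd.hasFDerivAt
    have hr : HasDerivAt (fun s => b (S s t0) * b (S s0 t))
        (fderiv ℝ b σ (S1 t0) * b (S s0 t)) s0 :=
      (hbσ.comp_hasDerivAt s0 h1.self_of_nhds).mul_const _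
    exact (hl.congr_of_eventuallyEq (hFt.mono fun s hs => hs.symm)).unique hr
  have hbσ : HasFDerivAt b (fderiv ℝ b σ) (S s0 t0) := by
    rw [h0]; exact hbd.hasFDerivAt
  have hfσ : HasFDerivAt (fderiv ℝ b) (fderiv ℝ (fderiv ℝ b) σ) (S s0 t0) := by
    rw [h0]; exact hfd.hasFDerivAt
  have hl : HasDerivAt (fun t => fderiv ℝ b (S s0 t) (S1 t) * b σ)
      ((fderiv ℝ (fderiv ℝ b) σ S2 (S1 t0) + fderiv ℝ b (S s0 t0) S12) * b σ) t0 :=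
    ((hfσ.comp_hasDerivAt t0 h2).clm_apply h12).mul_const _
  have hr : HasDerivAt (fun t => fderiv ℝ b σ (S1 t0) * b (S s0 t))
      (fderiv ℝ b σ (S1 t0) * fderiv ℝ b σ S2) t0 :=
    (hbσ.comp_hasDerivAt t0 h2).const_mul _
  rw [h0] at hl
  exact hl.unique (hr.congr_of_eventuallyEq hE)

lemma cubic_const_eq_zero {c0 c1 c2 c3 : ℂ} {u v : ℝ} (huv : u < v)
    (h : ∀ t ∈ Set.Ioo u v, c0 + c1 * (t : ℂ) + c2 * (t : ℂ) ^ 2 + c3 * (t : ℂ) ^ 3 = 0) :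
    c0 = 0 := by
  open Polynomial in
  let p : ℂ[X] := C c0 + C c1 * X + C c2 * X ^ 2 + C c3 * X ^ 3
  have hp : p = 0 := by
    refine Polynomial.eq_zero_of_infinite_isRoot p ?_
    refine ((Set.Ioo_infinite huv).image Complex.ofReal_injective.injOn).mono ?_
    rintro _ ⟨t, ht, rfl⟩
    simpa [p, Polynomial.IsRoot] using h t ht
  simpa [p] using congrArg (Polynomial.eval 0) hp

lemma inner_euc3 (x y : Euc 3) : ⟪x, y⟫ = x 0 * y 0 + x 1 * y 1 + x 2 * y 2 := by
  simp only [PiLp.inner_apply, Fin.sum_univ_three, RCLike.inner_apply, conj_trivial]; ring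

lemma cross3_zero (a b : Euc 3) : cross3 a b 0 = a 1 * b 2 - a 2 * b 1 := rfl

lemma cross3_one (a b : Euc 3) : cross3 a b 1 = a 2 * b 0 - a 0 * b 2 := rfl

lemma cross3_two (a b : Euc 3) : cross3 a b 2 = a 0 * b 1 - a 1 * b 0 := rfl

lemma gram_smul_eq_add_cross3 (a b x : Euc 3) :
    (⟪a, a⟫ * ⟪b, b⟫ - ⟪a, b⟫ ^ 2) • x
      = (⟪x, a⟫ * ⟪b, b⟫ - ⟪x, b⟫ * ⟪a, b⟫) • a + (⟪x, b⟫ * ⟪a, a⟫ - ⟪x, a⟫ * ⟪a, b⟫) • b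
        + ⟪x, cross3 a b⟫ • cross3 a b := by
  simp only [inner_euc3, cross3_zero, cross3_one, cross3_two]
  ext i
  fin_cases i <;>
    simp [cross3_zero, cross3_one, cross3_two] <;> ring

lemma inner_cross3_left (a b : Euc 3) : ⟪a, cross3 a b⟫ = 0 := by
  simp only [inner_euc3, cross3_zero, cross3_one, cross3_two]; ring

lemma inner_cross3_right (a b : Euc 3) : ⟪b, cross3 a b⟫ = 0 := by
  simp only [inner_euc3, cross3_zero, cross3_one, cross3_two]; ring

lemma inner_cross3_self (a b : Euc 3) :
    ⟪cross3 a b, cross3 a b⟫ = ⟪a, a⟫ * ⟪b, b⟫ - ⟪a, b⟫ ^ 2 := by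
  simp only [inner_euc3, cross3_zero, cross3_one, cross3_two]; ring

lemma norm_Hr {d : ℕ} {ν : Euc d} (hν : ‖ν‖ = 1) (x : Euc d) : ‖Hr ν x‖ = ‖x‖ := by
  have h : ⟪Hr ν x, Hr ν x⟫ = ⟪x, x⟫ := by
    simp only [Hr, inner_sub_left, inner_sub_right, real_inner_smul_left, real_inner_smul_right,
      real_inner_comm x ν]
    rw [real_inner_self_eq_norm_sq ν, hν]; ring
  rw [real_inner_self_eq_norm_sq, real_inner_self_eq_norm_sq] at h
  exact (sq_eq_sq₀ (norm_nonneg _) (norm_nonneg _)).1 h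

lemma continuous_Hr {d : ℕ} (ν : Euc d) : Continuous (Hr ν) := by
  unfold Hr; fun_prop

lemma Hr_smul {d : ℕ} (ν x : Euc d) (c : ℝ) : Hr ν (c • x) = c • Hr ν x := by
  simp only [Hr, real_inner_smul_left]; module

lemma mem_Sig2_of_norm {d : ℕ} {k0 : ℝ} {ν ω x : Euc d} (hν : ‖ν‖ = 1) (hx : ‖x‖ = k0)
    (h1 : 0 < ⟪x, ω⟫) (h2 : 0 < ⟪Hr ν x, ω⟫) : x ∈ Sig2 k0 ν ω :=
  ⟨⟨hx, h1⟩, ⟨(norm_Hr hν x).trans hx, h2⟩⟩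

lemma Sig2chi_mem_nhds {d : ℕ} {k0 χ : ℝ} (hk0 : 0 < k0) (hχ : 0 < χ) {ν ω σ : Euc d}
    (hν : ‖ν‖ = 1) (hσ : σ ∈ Sig2 k0 ν ω) : Sig2chi k0 χ ν ω ∈ 𝓝 σ := by
  have hn : ‖σ‖ = k0 := hσ.1.1
  have c1 : ContinuousAt (fun x : Euc d => ⟪x, ω⟫) σ := by fun_prop
  have c2 : ContinuousAt (fun x : Euc d => ⟪Hr ν x, ω⟫) σ :=
    ((continuous_Hr ν).inner continuous_const).continuousAt
  have c3 : ContinuousAt (fun x : Euc d => ‖x‖ / k0) σ := by fun_prop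
  have hIoo : ∀ᶠ x in 𝓝 σ, ‖x‖ / k0 ∈ Set.Ioo (1 - χ) (1 + χ) := by
    refine c3.eventually (Ioo_mem_nhds ?_ ?_) <;> simp only [hn, div_self hk0.ne'] <;> linarith
  have c4 : ∀ᶠ x in 𝓝 σ, 0 < ‖x‖ :=
    continuous_norm.continuousAt.eventually (lt_mem_nhds (by simpa only [hn] using hk0))
  filter_upwards [c1.eventually (lt_mem_nhds hσ.1.2), c2.eventually (lt_mem_nhds hσ.2.2), hIoo, c4]
    with x h1 h2 h3 h4
  refine ⟨(k0 / ‖x‖) • x, mem_Sig2_of_norm hν ?_ ?_ ?_, ‖x‖ / k0, h3, ?_⟩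
  · rw [norm_smul, Real.norm_of_nonneg (by positivity)]; field_simp
  · rw [real_inner_smul_left]; positivity
  · rw [Hr_smul, real_inner_smul_left]; positivity
  · rw [smul_smul, div_mul_div_cancel₀ hk0.ne', div_self h4.ne', one_smul]

set_option maxHeartbeats 1000000 in
/-- Along the two-parameter family `S s t` of decompositions of the points `p + s • ν` as `η - σ`,
the homogeneous system makes `b (S s t)` multiplicative; its mixed derivative gives a second-order
identity for `b` at `σ`. Here `η = h • ν + (M / P) • q + (D / P) • E` and `σ = lam • ν + q`. -/
lemma coupling_identity {k0 P lam h M D : ℝ} {ν ω q E : Euc 3} {b g : Euc 3 → ℂ}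
    (hk0 : 0 < k0) (hP : 0 < P) (hν : ‖ν‖ = 1) (hνq : ⟪ν, q⟫ = 0) (hνE : ⟪ν, E⟫ = 0)
    (hqE : ⟪q, E⟫ = 0) (hq : ⟪q, q⟫ = P) (hE : ⟪E, E⟫ = P) (hk : k0 ^ 2 = lam ^ 2 + P)
    (hσ : lam • ν + q ∈ Sig2 k0 ν ω) (hb : ContDiffAt ℝ 2 b (lam • ν + q))
    (hg : SolvesHom k0 ν ω e3 b g) (hgc : Continuous g)
    (hMD : M ^ 2 + D ^ 2 = P * (k0 ^ 2 - h ^ 2)) (hD : D ≠ 0)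
    (hη : 0 < ⟪h • ν + (M / P) • q + (D / P) • E, e3⟫)
    (hgη : g (h • ν + (M / P) • q + (D / P) • E - (lam • ν + q)) ≠ 0) :
    let σ := lam • ν + q
    let d1 := fderiv ℝ b σ
    let d2 := fderiv ℝ (fderiv ℝ b) σ
    let W1 := (h + M * lam / P) • E + D • ν - (D * lam / P) • q
    let W2 := (-h + M * lam / P) • E + D • ν - (D * lam / P) • q
    let γ := (D ^ 2 * (1 + k0 ^ 2 / P) + k0 ^ 2 * M ^ 2 / P - k0 ^ 2 * P) / P
    D • (d1 W1 * d1 W2 - d2 W2 W1 * b σ)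
      + d1 ((-2 * D ^ 2 - γ * (M - P)) • E + (D * γ) • q) * b σ = 0 := by
  intro σ d1 d2 W1 W2 γ
  obtain ⟨A, hA⟩ : ∃ A : ℝ, A = M - P := ⟨_, rfl⟩
  obtain ⟨p, hp⟩ : ∃ p : Euc 3, p = (A / P) • q + (D / P) • E := ⟨_, rfl⟩
  obtain ⟨n, hn⟩ : ∃ n : Euc 3, n = (A / P) • E - (D / P) • q := ⟨_, rfl⟩
  obtain ⟨r2, hr2⟩ : ∃ r2 : ℝ, r2 = (A ^ 2 + D ^ 2) / P := ⟨_, rfl⟩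
  have hr2P : r2 * P = A ^ 2 + D ^ 2 := by rw [hr2]; field_simp
  have hr2pos : 0 < r2 := by rw [hr2]; positivity
  obtain ⟨s0, hs0⟩ : ∃ s0, s0 = h - lam := ⟨_, rfl⟩
  obtain ⟨t0, ht0⟩ : ∃ t0, t0 = h + lam := ⟨_, rfl⟩
  have hst : s0 * t0 = -r2 - 2 * A := by
    have : P * (s0 * t0) = P * (-r2 - 2 * A) := by
      rw [hs0, ht0]
      linear_combination P * hk + hMD + hr2P + (A + P + M) * hA
    exact mul_left_cancel₀ hP.ne' this
  have hνν : ⟪ν, ν⟫ = 1 := by rw [real_inner_self_eq_norm_sq, hν]; norm_num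
  have hqν : ⟪q, ν⟫ = 0 := by rw [real_inner_comm, hνq]
  have hEν : ⟪E, ν⟫ = 0 := by rw [real_inner_comm, hνE]
  have hEq : ⟪E, q⟫ = 0 := by rw [real_inner_comm, hqE]
  have hpp : ⟪p, p⟫ = r2 := by
    simp only [hp, hr2, inner_add_left, inner_add_right, real_inner_smul_left,
      real_inner_smul_right, hqE, hEq, hq, hE]
    field_simp; ring
  have hnn : ⟪n, n⟫ = r2 := by
    simp only [hn, hr2, inner_sub_left, inner_sub_right, real_inner_smul_left,
      real_inner_smul_right, hqE, hEq, hq, hE]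
    field_simp; ring
  have hpn : ⟪p, n⟫ = 0 := by
    simp only [hp, hn, inner_add_left, inner_sub_right, real_inner_smul_left,
      real_inner_smul_right, hqE, hEq, hq, hE]
    field_simp; ring
  have hpν : ⟪p, ν⟫ = 0 := by
    simp only [hp, inner_add_left, real_inner_smul_left, hqν, hEν]; ring
  have hnν : ⟪n, ν⟫ = 0 := by
    simp only [hn, inner_sub_left, real_inner_smul_left, hqν, hEν]; ring
  have hnp : ⟪n, p⟫ = 0 := by rw [real_inner_comm, hpn]
  have hνp : ⟪ν, p⟫ = 0 := by rw [real_inner_comm, hpν]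
  have hνn : ⟪ν, n⟫ = 0 := by rw [real_inner_comm, hnν]
  let w : ℝ → ℝ → ℝ := fun s t =>
    (k0 ^ 2 - (t - s) ^ 2 / 4 - (r2 + s * t) ^ 2 / (4 * r2)) * (r2 / D ^ 2)
  let S : ℝ → ℝ → Euc 3 := fun s t => ((t - s) / 2) • ν + (-(r2 + s * t) / (2 * r2)) • p
    + ((-D / r2) * Real.sqrt (w s t)) • n
  have hw0 : w s0 t0 = 1 := by
    have e₁ : k0 ^ 2 - (t0 - s0) ^ 2 / 4 = P := by
      rw [hs0, ht0]; linear_combination hk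
    simp only [w, e₁, hst]
    field_simp
    linear_combination 4 * hr2P
  have hS0 : S s0 t0 = σ := by
    simp only [S, hw0, hst, Real.sqrt_one, σ]
    have e₁ : (t0 - s0) / 2 = lam := by rw [hs0, ht0]; ring
    have e₂ : -(r2 + (-r2 - 2 * A)) / (2 * r2) = A / r2 := by field_simp; ring
    rw [e₁, e₂, hp, hn, hr2]
    match_scalars
    · ring
    · field_simp
    · field_simp; ring
  have hη0 : h • ν + (M / P) • q + (D / P) • E = σ + p + s0 • ν := by
    simp only [σ, hp, hs0, hA]
    match_scalars
    · ring
    · field_simp; ring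
    · ring
  have hSc : Continuous fun x : ℝ × ℝ => S x.1 x.2 := by
    simp only [S, w]; fun_prop
  have hSn : ∀ s t, 0 ≤ w s t → ‖S s t‖ = k0 := by
    intro s t hw
    have e : ⟪S s t, S s t⟫ = k0 ^ 2 := by
      simp only [S, inner_add_left, inner_add_right, real_inner_smul_left, real_inner_smul_right,
        hνν, hpp, hnn, hpn, hpν, hnν, hnp, hνp, hνn]
      have := Real.mul_self_sqrt hw
      have e₂ : w s t * (D ^ 2 / r2)
          = k0 ^ 2 - (t - s) ^ 2 / 4 - (r2 + s * t) ^ 2 / (4 * r2) := by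
        simp only [w]; field_simp
      have hsq : (-D / r2) * Real.sqrt (w s t) * ((-D / r2) * Real.sqrt (w s t) * r2)
          = w s t * (D ^ 2 / r2) := by
        rw [show (-D / r2) * Real.sqrt (w s t) * ((-D / r2) * Real.sqrt (w s t) * r2)
          = Real.sqrt (w s t) * Real.sqrt (w s t) * (D ^ 2 / r2) by field_simp, this]
      simp only [mul_zero, add_zero, zero_add, mul_one]
      rw [hsq, e₂]; field_simp; ring
    rw [real_inner_self_eq_norm_sq] at e
    exact (sq_eq_sq₀ (norm_nonneg _) hk0.le).1 e
  have hSν : ∀ s t, ⟪S s t, ν⟫ = (t - s) / 2 := by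
    intro s t
    simp only [S, inner_add_left, real_inner_smul_left, hνν, hpν, hnν]; ring
  have hSp : ∀ s t, ⟪S s t, p⟫ = -(r2 + s * t) / 2 := by
    intro s t
    simp only [S, inner_add_left, real_inner_smul_left, hνp, hpp, hnp]; field_simp; ring
  have hηn : ∀ s t, 0 ≤ w s t → ‖S s t + p + s • ν‖ = k0 := by
    intro s t hw
    have e0 := hSn s t hw
    have e : ⟪S s t + p + s • ν, S s t + p + s • ν⟫ = k0 ^ 2 := by
      simp only [inner_add_left, inner_add_right, real_inner_smul_left, real_inner_smul_right,
        real_inner_comm (S s t) p, real_inner_comm (S s t) ν, hSν, hSp,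
        hνν, hpp, hpν, hνp]
      rw [real_inner_self_eq_norm_sq, e0]
      ring
    rw [real_inner_self_eq_norm_sq] at e
    exact (sq_eq_sq₀ (norm_nonneg _) hk0.le).1 e
  let good : ℝ × ℝ → Prop := fun x =>
    b (S x.1 x.2) * g (p + x.1 • ν) + g (p + x.2 • ν) = 0
  have hgood : ∀ᶠ x in 𝓝 (s0, t0), good x := by
    have wc : Continuous fun x : ℝ × ℝ => w x.1 x.2 := by simp only [w]; fun_prop
    have c1 : Continuous fun x : ℝ × ℝ => ⟪S x.1 x.2, ω⟫ := hSc.inner continuous_const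
    have c2 : Continuous fun x : ℝ × ℝ => ⟪Hr ν (S x.1 x.2), ω⟫ :=
      ((continuous_Hr ν).comp hSc).inner continuous_const
    have c3 : Continuous fun x : ℝ × ℝ => ⟪S x.1 x.2 + p + x.1 • ν, e3⟫ :=
      ((hSc.add continuous_const).add (by fun_prop)).inner continuous_const
    filter_upwards [wc.continuousAt.eventually (lt_mem_nhds (a := 0) (by simp [hw0])),
      c1.continuousAt.eventually (lt_mem_nhds (a := 0) (by simpa only [hS0] using hσ.1.2)),
      c2.continuousAt.eventually (lt_mem_nhds (a := 0) (by simpa only [hS0] using hσ.2.2)),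
      c3.continuousAt.eventually (lt_mem_nhds (a := 0) (by simpa only [hS0, ← hη0] using hη))]
      with x h1 h2 h3 h4
    have hS2 := mem_Sig2_of_norm hν (hSn _ _ h1.le) h2 h3
    have := (hg _ ⟨hηn _ _ h1.le, h4⟩).2 _ hS2
    have e₁ : S x.1 x.2 + p + x.1 • ν - S x.1 x.2 = p + x.1 • ν := by abel
    have e₂ : S x.1 x.2 + p + x.1 • ν - Hr ν (S x.1 x.2) = p + x.2 • ν := by
      rw [Hr, hSν]; module
    rwa [e₁, e₂] at this
  have hg0 : ∀ᶠ s in 𝓝 s0, g (p + s • ν) ≠ 0 := by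
    have c : Continuous fun s : ℝ => g (p + s • ν) := by fun_prop
    refine c.continuousAt.eventually_ne ?_
    rw [hη0] at hgη
    convert hgη using 2
    simp only [σ]; abel
  have hF : ∀ᶠ t in 𝓝 t0, ∀ᶠ s in 𝓝 s0, b (S s t) * b σ = b (S s t0) * b (S s0 t) := by
    have hsw : Tendsto (fun x : ℝ × ℝ => (x.2, x.1)) (𝓝 (t0, s0)) (𝓝 (s0, t0)) :=
      continuous_swap.tendsto _
    have ha : Tendsto (fun x : ℝ × ℝ => (x.2, t0)) (𝓝 (t0, s0)) (𝓝 (s0, t0)) :=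
      (by fun_prop : Continuous fun x : ℝ × ℝ => (x.2, t0)).tendsto _
    have hb' : Tendsto (fun x : ℝ × ℝ => (s0, x.1)) (𝓝 (t0, s0)) (𝓝 (s0, t0)) :=
      (by fun_prop : Continuous fun x : ℝ × ℝ => (s0, x.1)).tendsto _
    have hc : Tendsto (fun x : ℝ × ℝ => x.2) (𝓝 (t0, s0)) (𝓝 s0) :=
      continuous_snd.tendsto _
    refine Filter.Eventually.curry_nhds (p := fun x : ℝ × ℝ =>
      b (S x.2 x.1) * b σ = b (S x.2 t0) * b (S s0 x.1)) ?_
    filter_upwards [hsw.eventually hgood, ha.eventually hgood, hb'.eventually hgood,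
      hc.eventually hg0] with x h1 h2 h3 h4
    have h5 := hgood.self_of_nhds
    simp only [good] at h1 h2 h3 h5
    rw [hS0] at h5
    have h6 := hg0.self_of_nhds
    refine mul_right_cancel₀ (mul_ne_zero h4 h6) ?_
    linear_combination (b σ * g (p + s0 • ν)) * h1 - g (p + x.1 • ν) * h5
      - (b (S s0 x.1) * g (p + s0 • ν)) * h2 + g (p + t0 • ν) * h3
  let c := r2 / D ^ 2
  let ws : ℝ → ℝ := fun t => ((t - s0) / 2 - t * (r2 + s0 * t) / (2 * r2)) * c
  let wt : ℝ := (-(t0 - s0) / 2 - s0 * (r2 + s0 * t0) / (2 * r2)) * c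
  let wst : ℝ := (1 / 2 - (r2 + 2 * s0 * t0) / (2 * r2)) * c
  let S1 : ℝ → Euc 3 := fun t => (-1 / 2 : ℝ) • ν + (-t / (2 * r2)) • p
    + ((-D / r2) * (ws t / (2 * Real.sqrt (w s0 t)))) • n
  let S2 : Euc 3 := (1 / 2 : ℝ) • ν + (-s0 / (2 * r2)) • p + ((-D / r2) * (wt / 2)) • n
  let S12 : Euc 3 := (-1 / (2 * r2)) • p + ((-D / r2) * (wst / 2 - ws t0 * wt / 4)) • n
  have hwt : HasDerivAt (w s0) wt t0 := by
    have := ((((hasDerivAt_const t0 (k0 ^ 2)).sub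
      ((((hasDerivAt_id t0).sub_const s0).pow 2).div_const 4)).sub
      (((((hasDerivAt_id t0).const_mul s0).const_add r2).pow 2).div_const (4 * r2))).mul_const c)
    refine this.congr_deriv ?_
    simp only [wt, id]; push_cast; field_simp; ring
  have hws : ∀ t, HasDerivAt (fun s => w s t) (ws t) s0 := by
    intro t
    have := ((((hasDerivAt_const s0 (k0 ^ 2)).sub
      ((((hasDerivAt_id s0).const_sub t).pow 2).div_const 4)).sub
      (((((hasDerivAt_id s0).mul_const t).const_add r2).pow 2).div_const (4 * r2))).mul_const c)
    refine this.congr_deriv ?_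
    simp only [ws, id]; push_cast; field_simp; ring
  have hwst : HasDerivAt ws wst t0 := by
    have := ((((hasDerivAt_id t0).sub_const s0).div_const 2).sub
      (((hasDerivAt_id t0).mul (((hasDerivAt_id t0).const_mul s0).const_add r2)).div_const
        (2 * r2))).mul_const c
    refine this.congr_deriv ?_
    simp only [wst, id]; field_simp; ring
  have hwpos : ∀ᶠ t in 𝓝 t0, 0 < w s0 t :=
    hwt.continuousAt.eventually (lt_mem_nhds (by simp [hw0]))
  have h1 : ∀ᶠ t in 𝓝 t0, HasDerivAt (fun s => S s t) (S1 t) s0 := by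
    filter_upwards [hwpos] with t ht
    have a1 : HasDerivAt (fun s : ℝ => (t - s) / 2) (-1 / 2) s0 :=
      ((hasDerivAt_id s0).const_sub t).div_const 2
    have a2 : HasDerivAt (fun s : ℝ => -(r2 + s * t) / (2 * r2)) (-t / (2 * r2)) s0 := by
      simpa using (((hasDerivAt_id s0).mul_const t).const_add r2).neg.div_const (2 * r2)
    have a3 := ((hws t).sqrt ht.ne').const_mul (-D / r2)
    exact ((a1.smul_const ν).add (a2.smul_const p)).add (a3.smul_const n)
  have h2 : HasDerivAt (S s0) S2 t0 := by
    have a1 : HasDerivAt (fun t : ℝ => (t - s0) / 2) (1 / 2) t0 :=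
      ((hasDerivAt_id t0).sub_const s0).div_const 2
    have a2 : HasDerivAt (fun t : ℝ => -(r2 + s0 * t) / (2 * r2)) (-s0 / (2 * r2)) t0 := by
      simpa using (((hasDerivAt_id t0).const_mul s0).const_add r2).neg.div_const (2 * r2)
    have a3 := (hwt.sqrt (by rw [hw0]; norm_num)).const_mul (-D / r2)
    rw [hw0, Real.sqrt_one, mul_one] at a3
    exact ((a1.smul_const ν).add (a2.smul_const p)).add (a3.smul_const n)
  have h12 : HasDerivAt S1 S12 t0 := by
    have a2 : HasDerivAt (fun t : ℝ => -t / (2 * r2)) (-1 / (2 * r2)) t0 :=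
      (hasDerivAt_id t0).neg.div_const (2 * r2)
    have a3 := (hwst.div ((hwt.sqrt (by rw [hw0]; norm_num)).const_mul 2)
      (by rw [hw0]; norm_num)).const_mul (-D / r2)
    have := ((a2.smul_const p).const_add ((-1 / 2 : ℝ) • ν)).add (a3.smul_const n)
    refine this.congr_deriv ?_
    simp only [S12, hw0, Real.sqrt_one]
    congr 2
    ring
  have main := mixed_deriv_of_multiplicative hb hS0 h1 h2 h12 hF
  have e0 : r2 + s0 * t0 = -2 * A := by rw [hst]; ring
  have eτs : (-D / r2) * (ws t0 / (2 * Real.sqrt (w s0 t0))) = -(lam + t0 * A / r2) / (2 * D) := by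
    simp only [ws, c, hw0, Real.sqrt_one, e0, show (t0 - s0) / 2 = lam by rw [hs0, ht0]; ring]
    field_simp; ring
  have eτt : (-D / r2) * (wt / 2) = -(-lam + s0 * A / r2) / (2 * D) := by
    simp only [wt, c, e0, show -(t0 - s0) / 2 = -lam by rw [hs0, ht0]; ring]
    field_simp; ring
  have eτst : (-D / r2) * (wst / 2 - ws t0 * wt / 4)
      = -(r2 + 2 * A) * (r2 * k0 ^ 2 + D ^ 2) / (4 * D ^ 3 * r2) := by
    have e₁ : (lam + t0 * A / r2) * (-lam + s0 * A / r2) * r2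
        = -(r2 + 2 * A) * (lam ^ 2 + A ^ 2 / r2) := by
      rw [hs0, ht0] at hst ⊢
      field_simp
      linear_combination (A ^ 2) * hst
    have e₂ : ws t0 = (lam + t0 * A / r2) * c := by
      simp only [ws, e0, show (t0 - s0) / 2 = lam by rw [hs0, ht0]; ring]
      field_simp; ring
    have ewt : wt = (-lam + s0 * A / r2) * c := by
      simp only [wt, e0, show -(t0 - s0) / 2 = -lam by rw [hs0, ht0]; ring]
      field_simp; ring
    have e4 : wst = (1 + 2 * A / r2) * c := by
      simp only [wst, show r2 + 2 * s0 * t0 = -r2 - 4 * A by linear_combination 2 * hst]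
      field_simp; ring
    have e5 : ws t0 * wt = -(r2 + 2 * A) * (lam ^ 2 + A ^ 2 / r2) * (c ^ 2 / r2) := by
      rw [e₂, ewt, ← e₁]; field_simp
    rw [e5, e4]
    simp only [c]
    field_simp
    linear_combination 2 * (r2 + 2 * A) * (hr2P + r2 * hk)
  have hS1 : S1 t0 = (-1 / (2 * D)) • W1 := by
    simp only [S1, eτs]
    simp only [W1, hp, hn, ht0]
    match_scalars
    · field_simp
    · field_simp
      ring
    · field_simp
      linear_combination (h + lam) * hr2P - lam * r2 * hA
  have hS2 : S2 = (1 / (2 * D)) • W2 := by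
    simp only [S2, eτt]
    simp only [W2, hp, hn, hs0]
    match_scalars
    · field_simp
    · field_simp
      ring
    · field_simp
      linear_combination (h - lam) * hr2P + lam * r2 * hA
  have hS12 : S12 = (1 / (4 * D ^ 3)) • ((-2 * D ^ 2 - γ * (M - P)) • E + (D * γ) • q) := by
    have eγ : γ = (D ^ 2 + (r2 + 2 * A) * k0 ^ 2) / P := by
      simp only [γ, hr2, hA]; field_simp; ring
    simp only [S12, eτst]
    simp only [hp, hn, eγ, ← hA]
    match_scalars
    · field_simp
      ring
    · field_simp
      linear_combination 4 * D ^ 2 * hr2P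
  change (d2 S2 (S1 t0) + d1 S12) * b σ = d1 (S1 t0) * d1 S2 at main
  rw [hS1, hS2, hS12] at main
  simp only [map_smul, _root_.smul_apply, Complex.real_smul] at main
  have hDc : (D : ℂ) ≠ 0 := Complex.ofReal_ne_zero.2 hD
  rw [Complex.real_smul]
  generalize d1 ((-2 * D ^ 2 - γ * (M - P)) • E + (D * γ) • q) = v at main ⊢
  push_cast at main
  field_simp at main
  linear_combination main / 4

/-- Moving `η` within an open set on which `g (η - σ) ≠ 0` turns `coupling_identity` into a
polynomial identity, whose constant coefficient is a nonzero multiple of the derivative of `b` at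
`σ` in the direction `E`. -/
lemma fderiv_eq_zero_of_coupling_identity {k0 P lam h0 M0 D0 : ℝ} {ν ω q E : Euc 3}
    {b g : Euc 3 → ℂ}
    (hk0 : 0 < k0) (hP : 0 < P) (hν : ‖ν‖ = 1) (hνq : ⟪ν, q⟫ = 0) (hνE : ⟪ν, E⟫ = 0)
    (hqE : ⟪q, E⟫ = 0) (hq : ⟪q, q⟫ = P) (hE : ⟪E, E⟫ = P) (hk : k0 ^ 2 = lam ^ 2 + P)
    (hσ : lam • ν + q ∈ Sig2 k0 ν ω) (hb : ContDiffAt ℝ 2 b (lam • ν + q))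
    (hbσ : b (lam • ν + q) ≠ 0)
    (hg : SolvesHom k0 ν ω e3 b g) (hgc : Continuous g)
    (hMD : M0 ^ 2 + D0 ^ 2 = P * (k0 ^ 2 - h0 ^ 2)) (hD : D0 ≠ 0)
    (hη : 0 < ⟪h0 • ν + (M0 / P) • q + (D0 / P) • E, e3⟫)
    (hgη : g (h0 • ν + (M0 / P) • q + (D0 / P) • E - (lam • ν + q)) ≠ 0) :
    fderiv ℝ b (lam • ν + q) E = 0 := by
  obtain ⟨ε, hε, hεh⟩ : ∃ ε : ℝ, ε ^ 2 = 1 ∧ ε * Real.sqrt (h0 ^ 2) = h0 := by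
    rw [Real.sqrt_sq_eq_abs]
    rcases le_total 0 h0 with h | h
    · exact ⟨1, by norm_num, by rw [abs_of_nonneg h, one_mul]⟩
    · exact ⟨-1, by norm_num, by rw [abs_of_nonpos h]; ring⟩
  let H : ℝ × ℝ → ℝ := fun x =>
    ε * Real.sqrt (k0 ^ 2 - ((x.1 * M0) ^ 2 + (x.2 * D0) ^ 2) / P)
  let N : ℝ × ℝ → Euc 3 := fun x => H x • ν + (x.1 * M0 / P) • q + (x.2 * D0 / P) • E
  have hHc : Continuous H := by simp only [H]; fun_prop
  have hNc : Continuous N := by simp only [N]; fun_prop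
  have hH0 : H (1, 1) = h0 := by
    simp only [H, one_mul, hMD]
    rw [mul_div_cancel_left₀ _ hP.ne', sub_sub_cancel, hεh]
  have hN0 : N (1, 1) = h0 • ν + (M0 / P) • q + (D0 / P) • E := by
    simp only [N, hH0, one_mul]
  have hev : ∀ᶠ x in 𝓝 ((1 : ℝ), (1 : ℝ)), 0 < ⟪N x, e3⟫ ∧ g (N x - (lam • ν + q)) ≠ 0 := by
    refine Filter.Eventually.and ?_ ?_
    · exact (hNc.inner continuous_const).continuousAt.eventually
        (lt_mem_nhds (by simpa only [hN0] using hη))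
    · exact (hgc.comp (hNc.sub continuous_const)).continuousAt.eventually_ne
        (by change g (N (1, 1) - (lam • ν + q)) ≠ 0; rwa [hN0])
  obtain ⟨δ, hδ, hball⟩ := Metric.eventually_nhds_iff_ball.1 hev
  set r := max (1 / 2) (1 - δ) with hr
  have hr1 : r < 1 := max_lt (by norm_num) (by linarith)
  have hr0 : 0 < r := lt_of_lt_of_le (by norm_num) (le_max_left _ _)
  have hbox : ∀ x ∈ Set.Ioo r 1, ∀ z ∈ Set.Ioo r 1,
      0 < ⟪N (x, z), e3⟫ ∧ g (N (x, z) - (lam • ν + q)) ≠ 0 := by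
    intro x hx z hz
    have hrδ : 1 - δ ≤ r := le_max_right _ _
    refine hball _ ?_
    rw [Metric.mem_ball, Prod.dist_eq, Real.dist_eq, Real.dist_eq]
    simp only [max_lt_iff, abs_lt]
    obtain ⟨h1, h2⟩ := hx
    obtain ⟨h3, h4⟩ := hz
    refine ⟨⟨?_, ?_⟩, ⟨?_, ?_⟩⟩ <;> linarith
  obtain ⟨x, hx, hxM⟩ : ∃ x ∈ Set.Ioo r 1, x ∉ ({P / M0, -P / M0} : Set ℝ) :=
    ((Set.Ioo_infinite hr1).sdiff (Set.toFinite _)).nonempty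
  set M := x * M0 with hM
  have hMne : ∀ c : ℝ, c ≠ 0 → x ≠ c / M0 → M ≠ c := by
    intro c hc hxc h
    rcases eq_or_ne M0 0 with h0 | h0
    · exact hc (by rw [← h, hM, h0, mul_zero])
    · exact hxc (by rw [← h, hM]; field_simp)
  simp only [Set.mem_insert_iff, Set.mem_singleton_iff, not_or] at hxM
  have hM1 : M - P ≠ 0 := sub_ne_zero.2 (hMne P hP.ne' hxM.1)
  have hM2 : M + P ≠ 0 := fun h =>
    hMne (-P) (neg_ne_zero.2 hP.ne') hxM.2 (by linarith)
  set σ := lam • ν + q with hσdef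
  set d1 := fderiv ℝ b σ with hd1
  set d2 := fderiv ℝ (fderiv ℝ b) σ with hd2
  have hsymm : ∀ u v, d2 u v = d2 v u := fun u v =>
    (hb.isSymmSndFDerivAt (by simp)).eq u v
  let T : Euc 3 := ν - (lam / P) • q
  let Q : Euc 3 → Euc 3 → ℂ := fun u v => d1 u * d1 v - d2 u v * b σ
  have hcub : ∀ z ∈ Set.Ioo r 1,
      -(k0 ^ 2 * (M ^ 2 - P ^ 2) * (M - P) / P ^ 2 * d1 E * b σ)
      + D0 * (Q E E * ((M * lam / P) ^ 2 - k0 ^ 2 + M ^ 2 / P)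
        + d1 q * b σ * (k0 ^ 2 * (M ^ 2 - P ^ 2) / P ^ 2)) * (z : ℂ)
      + D0 ^ 2 * (2 * (M * lam / P) * Q E T
        - (2 + (1 + k0 ^ 2 / P) / P * (M - P)) * d1 E * b σ) * (z : ℂ) ^ 2
      + D0 ^ 3 * (Q T T + Q E E / P + (1 + k0 ^ 2 / P) / P * d1 q * b σ) * (z : ℂ) ^ 3
        = 0 := by
    intro z hz
    obtain ⟨h1, h2⟩ := hbox x hx z hz
    set D := z * D0 with hDdef
    set h := H (x, z) with hh
    have hx0 : 0 < x := hr0.trans hx.1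
    have hz0 : 0 < z := hr0.trans hz.1
    have hh2 : h ^ 2 = k0 ^ 2 - (M ^ 2 + D ^ 2) / P := by
      have hle : (M ^ 2 + D ^ 2) / P ≤ k0 ^ 2 := by
        rw [div_le_iff₀ hP, hM, hDdef]
        have a1 : (x * M0) ^ 2 ≤ M0 ^ 2 := by
          rw [mul_pow]; exact mul_le_of_le_one_left (sq_nonneg _) (by nlinarith [hx.2])
        have a2 : (z * D0) ^ 2 ≤ D0 ^ 2 := by
          rw [mul_pow]; exact mul_le_of_le_one_left (sq_nonneg _) (by nlinarith [hz.2])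
        nlinarith [sq_nonneg h0]
      simp only [hh, H, mul_pow ε, hε, one_mul]
      exact Real.sq_sqrt (sub_nonneg.2 hle)
    have key := coupling_identity (h := h) (M := M) (D := D) hk0 hP hν hνq hνE hqE hq hE hk hσ hb
      hg hgc (by rw [hh2]; field_simp; ring) (mul_ne_zero hz0.ne' hD) h1 h2
    have hW : ∀ a : ℝ, a • E + D • ν - (D * lam / P) • q = a • E + D • T := by
      intro a; simp only [T]; module
    simp only [hW] at key
    change D • (d1 _ * d1 _ - d2 _ _ * b σ) + d1 _ * b σ = 0 at key
    simp only [map_add, map_smul, _root_.add_apply, _root_.smul_apply, Complex.real_smul,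
      hsymm T E] at key
    have hh2c : (h : ℂ) ^ 2 = k0 ^ 2 - (M ^ 2 + D ^ 2) / P := by exact_mod_cast hh2
    have hDc : (D : ℂ) = z * D0 := by rw [hDdef]; push_cast; ring
    have hPc : (P : ℂ) ≠ 0 := Complex.ofReal_ne_zero.2 hP.ne'
    simp only [Q]
    push_cast at key
    clear_value M
    rw [hDc] at key hh2c
    have hPinv : (P : ℂ) * (P : ℂ)⁻¹ = 1 := mul_inv_cancel₀ hPc
    linear_combination key + z * D0 * (d1 E * d1 E - d2 E E * b σ) * hh2c
      + P * (P : ℂ)⁻¹ * k0 ^ 2 * b σ * (M * d1 E - D0 * z * d1 q - P * d1 E) * hPinv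
  have h0 := cubic_const_eq_zero hr1 hcub
  have hkc : (k0 : ℂ) ^ 2 ≠ 0 := pow_ne_zero _ (Complex.ofReal_ne_zero.2 hk0.ne')
  have hPc : (P : ℂ) ^ 2 ≠ 0 := pow_ne_zero _ (Complex.ofReal_ne_zero.2 hP.ne')
  have hM1c : (M : ℂ) - P ≠ 0 := by exact_mod_cast hM1
  have hM2c : (M : ℂ) + P ≠ 0 := by exact_mod_cast hM2
  have hM3 : (M : ℂ) ^ 2 - P ^ 2 ≠ 0 := by rw [sq_sub_sq]; exact mul_ne_zero hM2c hM1c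
  rw [neg_eq_zero] at h0
  refine (mul_eq_zero.1 ((mul_eq_zero.1 h0).resolve_right hbσ)).resolve_left ?_
  exact div_ne_zero (mul_ne_zero (mul_ne_zero hkc hM3) hM1c) hPc

/-- if `Db(σ)(ν × σ) ≠ 0`, every continuous solution satisfies `g(η − σ) = 0`. -/
theorem stmt13 (k0 : ℝ) (hk0 : 0 < k0)
    (ν ω : Euc 3) (hν : ‖ν‖ = 1) (hω : ‖ω‖ = 1)
    (χ : ℝ) (hχ : χ ∈ Set.Ioo (0 : ℝ) 1)
    (b : Euc 3 → ℂ) (hb : BHyp k0 χ ν ω b)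
    (hb2 : ContDiffOn ℝ 2 b (Sig2chi k0 χ ν ω))
    (η σ : Euc 3) (hη : η ∈ Shemi k0 e3) (hσ : σ ∈ Sig2 k0 ν ω)
    (hind : LinearIndependent ℝ ![η, σ, ν])
    (g : Euc 3 → ℂ) (hgc : Continuous g) (hg : SolvesHom k0 ν ω e3 b g)
    (hDb : fderiv ℝ b σ (cross3 ν σ) ≠ 0) :
    g (η - σ) = 0 := by
  by_contra hne
  set lam := ⟪σ, ν⟫ with hlam
  set q := σ - lam • ν with hqdef
  set E := cross3 ν σ with hEdef
  set P := k0 ^ 2 - lam ^ 2 with hPdef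
  have hνν : ⟪ν, ν⟫ = 1 := by rw [real_inner_self_eq_norm_sq, hν]; norm_num
  have hσσ : ⟪σ, σ⟫ = k0 ^ 2 := by rw [real_inner_self_eq_norm_sq, hσ.1.1]
  have hηη : ⟪η, η⟫ = k0 ^ 2 := by rw [real_inner_self_eq_norm_sq, hη.1]
  have hνσ : ⟪ν, σ⟫ = lam := real_inner_comm _ _
  have hνE : ⟪ν, E⟫ = 0 := inner_cross3_left ν σ
  have hσE : ⟪σ, E⟫ = 0 := inner_cross3_right ν σ
  have hEE : ⟪E, E⟫ = P := by rw [hEdef, inner_cross3_self, hνν, hσσ, hνσ]; ring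
  have hνq : ⟪ν, q⟫ = 0 := by
    simp only [hqdef, inner_sub_right, real_inner_smul_right, hνν, hνσ]; ring
  have hqE : ⟪q, E⟫ = 0 := by
    simp only [hqdef, inner_sub_left, real_inner_smul_left, hσE, hνE]; ring
  have hqq : ⟪q, q⟫ = P := by
    simp only [hqdef, inner_sub_left, inner_sub_right, real_inner_smul_left,
      real_inner_smul_right, hνν, hνσ, hσσ, ← hlam]
    ring
  have hσq : lam • ν + q = σ := by rw [hqdef]; abel
  have hli := Fintype.linearIndependent_iff.1 hind
  have hqne : q ≠ 0 := by
    intro h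
    have := hli ![0, 1, -lam] (by
      simpa [Fin.sum_univ_three, sub_eq_add_neg, hqdef] using h) 1
    simp at this
  have hP : 0 < P := by rw [← hqq]; exact real_inner_self_pos.2 hqne
  have hgram := gram_smul_eq_add_cross3 ν σ η
  rw [hνν, hσσ, hνσ, one_mul, ← hPdef, ← hEdef] at hgram
  have hD : ⟪η, E⟫ ≠ 0 := by
    intro h
    rw [h] at hgram
    have := hli ![P, -(⟪η, σ⟫ * 1 - ⟪η, ν⟫ * lam), -(⟪η, ν⟫ * k0 ^ 2 - ⟪η, σ⟫ * lam)] (by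
      simp only [Fin.sum_univ_three, Matrix.cons_val]
      rw [hgram]; module) 0
    exact hP.ne' this
  have hηeq : ⟪η, ν⟫ • ν + (⟪η, q⟫ / P) • q + (⟪η, E⟫ / P) • E = η := by
    refine smul_right_injective _ hP.ne' ?_
    simp only
    rw [hgram]
    simp only [hqdef, inner_sub_right, real_inner_smul_right]
    match_scalars
    · field_simp; rw [hPdef]; ring
    · field_simp
    · field_simp
  have hMD : ⟪η, q⟫ ^ 2 + ⟪η, E⟫ ^ 2 = P * (k0 ^ 2 - ⟪η, ν⟫ ^ 2) := by
    have h1 := congrArg (fun x => ⟪η, x⟫) hηeq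
    simp only [inner_add_right, real_inner_smul_right, hηη] at h1
    field_simp at h1
    linear_combination h1
  have hσmem : σ ∈ Sig2chi k0 χ ν ω :=
    mem_of_mem_nhds (Sig2chi_mem_nhds hk0 hχ.1 hν hσ)
  have hbd : ContDiffAt ℝ 2 b σ := hb2.contDiffAt (Sig2chi_mem_nhds hk0 hχ.1 hν hσ)
  have hfin := fderiv_eq_zero_of_coupling_identity (lam := lam) (q := q) (E := E) (ω := ω)
    hk0 hP hν hνq hνE hqE hqq hEE (by rw [hPdef]; ring) (by rwa [hσq]) (by rwa [hσq])
    (by rw [hσq]; exact hb.1 σ hσmem) hg hgc hMD hD (by rw [hηeq]; exact hη.2)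
    (by rwa [hηeq, hσq])
  rw [hσq] at hfin
  exact hDb hfin
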